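/- arXiv:1910.08155 — 2 statements merged into one kernel-verified Lean document; each statement's English description precedes it below -/
import Mathlib

section
/- Let D ≥ 1, let S be a finite nonempty subset of ℤ^D, let i be a natural number with i < |S|, and let p be the i-th element of S in lexicographic order (0-indexed). Let c = |{x ∈ S : x_1 < p_1}|, where x_1 denotes the first coordinate. Then: (1) p_1 is the unique integer a satisfying |{x ∈ S : x_1 < a}| ≤ i < |{x ∈ S : x_1 ≤ a}|; and (2) the tail (p_2, …, p_D) is the (i − c)-th element, in lexicographic order on ℤ^{D−1}, of the set {(x_2, …, x_D) : x ∈ S and x_1 = p_1}. -/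
/-- Strict lexicographic order on integer vectors: `x <_lex y` iff the first coordinate at
which they differ is smaller in `x`. -/
def lexLt {n : ℕ} (x y : Fin n → ℤ) : Prop :=
  ∃ j : Fin n, (∀ k : Fin n, k < j → x k = y k) ∧ x j < y j

instance {n : ℕ} (x y : Fin n → ℤ) : Decidable (lexLt x y) := by
  unfold lexLt; infer_instance

theorem not_lexLt_self {n : ℕ} (x : Fin n → ℤ) : ¬ lexLt x x := by
  rintro ⟨j, -, hj⟩
  exact lt_irrefl _ hj

theorem lexLt_succ_iff {n : ℕ} (x y : Fin (n + 1) → ℤ) :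
    lexLt x y ↔ x 0 < y 0 ∨
      x 0 = y 0 ∧ lexLt (fun j : Fin n => x j.succ) (fun j : Fin n => y j.succ) := by
  simp [lexLt, Fin.exists_fin_succ, Fin.forall_fin_succ, and_assoc]

theorem injOn_tail_filter_zero_eq {n : ℕ} (S : Finset (Fin (n + 1) → ℤ)) (a : ℤ) :
    Set.InjOn (fun (x : Fin (n + 1) → ℤ) (j : Fin n) => x j.succ)
      (S.filter (fun x => x 0 = a)) := by
  intro x hx y hy hxy
  simp only [Finset.coe_filter, Set.mem_ofPred_eq] at hx hy
  funext j
  exact Fin.cases (hx.2.trans hy.2.symm) (fun k => congrFun hxy k) j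

theorem card_filter_lexLt_succ {n : ℕ} (S : Finset (Fin (n + 1) → ℤ)) (p : Fin (n + 1) → ℤ) :
    (S.filter (fun x => lexLt x p)).card =
      (S.filter (fun x => x 0 < p 0)).card +
        (((S.filter (fun x => x 0 = p 0)).image (fun x (j : Fin n) => x j.succ)).filter
          (fun y => lexLt y (fun j : Fin n => p j.succ))).card := by
  rw [Finset.filter_image, Finset.card_image_of_injOn
    ((injOn_tail_filter_zero_eq S (p 0)).mono (Finset.coe_subset.2 (Finset.filter_subset _ _))),
    Finset.filter_filter, ← Finset.card_union_of_disjoint, ← Finset.filter_or]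
  · simp only [lexLt_succ_iff]
  · exact Finset.disjoint_filter.2 fun x _ h h' => h.ne h'.1

/-- Per-coordinate recursion of Algorithm 1, first step.  Let `S ⊆ ℤ^(D+1)` be finite and
nonempty, `i < |S|`, and let `p` be the `i`-th element of `S` in lexicographic order
(i.e. `p ∈ S` and exactly `i` elements of `S` are lex-smaller than `p`).  Then, with
`c = |{x ∈ S : x_1 < p_1}|`:
(1) `p_1` is the unique integer `a` with `|{x ∈ S : x_1 < a}| ≤ i < |{x ∈ S : x_1 ≤ a}|`;
(2) the tail of `p` is the `(i − c)`-th element, in lex order on `ℤ^D`, of the set of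
tails of the elements of `S` whose first coordinate is `p_1`. -/
theorem ith_lex_point_first_coordinate (D : ℕ) (S : Finset (Fin (D + 1) → ℤ)) (i : ℕ)
    (hi : i < S.card) (p : Fin (D + 1) → ℤ) (hp : p ∈ S)
    (hip : (S.filter (fun x => lexLt x p)).card = i) :
    (((S.filter (fun x => x 0 < p 0)).card ≤ i ∧
        i < (S.filter (fun x => x 0 ≤ p 0)).card) ∧
      ∀ a : ℤ,
        ((S.filter (fun x => x 0 < a)).card ≤ i ∧
          i < (S.filter (fun x => x 0 ≤ a)).card) → a = p 0) ∧
    (fun j : Fin D => p j.succ) ∈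
        (S.filter (fun x => x 0 = p 0)).image (fun x (j : Fin D) => x j.succ) ∧
    (((S.filter (fun x => x 0 = p 0)).image (fun x (j : Fin D) => x j.succ)).filter
          (fun y => lexLt y (fun j : Fin D => p j.succ))).card
      = i - (S.filter (fun x => x 0 < p 0)).card := by
  have hsplit := card_filter_lexLt_succ S p
  have hle : i < (S.filter (fun x => x 0 ≤ p 0)).card := by
    rw [← hip]
    refine Finset.card_lt_card ((Finset.ssubset_iff_of_subset ?_).2
      ⟨p, by simp [hp], by simp [not_lexLt_self]⟩)
    refine Finset.monotone_filter_right S fun x _ hx => ?_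
    rcases (lexLt_succ_iff x p).1 hx with h | h
    · exact h.le
    · exact h.1.le
  refine ⟨⟨⟨by omega, hle⟩, ?_⟩, ?_, by omega⟩
  · rintro a ⟨ha, ha'⟩
    rcases lt_trichotomy a (p 0) with h | h | h
    · have := Finset.card_le_card (Finset.monotone_filter_right S
        fun x _ (hx : x 0 ≤ a) => hx.trans_lt h)
      omega
    · exact h
    · have := Finset.card_le_card (Finset.monotone_filter_right S
        fun x _ (hx : x 0 ≤ p 0) => hx.trans_lt h)
      omega
  · exact Finset.mem_image.2 ⟨p, by simp [hp], rfl⟩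
end

section
/- Let D ≥ 1, let S be a finite subset of ℤ^D, let i < |S|, and let p be the i-th element of S in lexicographic order (0-indexed). For each d with 1 ≤ d ≤ D, define S_d = {x ∈ S : x_j = p_j for all j < d} and i_d = i − |{x ∈ S : (x_1, …, x_{d−1}) <_lex (p_1, …, p_{d−1})}|. Then for every d, the coordinate p_d is the unique integer a satisfying |{x ∈ S_d : x_d < a}| ≤ i_d < |{x ∈ S_d : x_d ≤ a}|. In particular, the point p is completely determined by the cardinalities of intersections of S with axis-parallel half-spaces of the form {x_j = p_j for j < d, x_d < a}. -/
/-- A vector is lexicographically smaller than `p` iff its prefix before `d` is, or the prefixes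
agree and the vector is smaller. -/
theorem lexLt_iff_prefix {n : ℕ} (d : Fin n) (x p : Fin n → ℤ) :
    lexLt x p ↔
      (∃ j : Fin n, j < d ∧ (∀ k : Fin n, k < j → x k = p k) ∧ x j < p j) ∨
        (∀ j : Fin n, j < d → x j = p j) ∧ lexLt x p := by
  constructor
  · rintro ⟨j, hj, hlt⟩
    rcases lt_or_ge j d with hjd | hjd
    · exact Or.inl ⟨j, hjd, hj, hlt⟩
    · exact Or.inr ⟨fun k hk => hj k (hk.trans_le hjd), j, hj, hlt⟩
  · rintro (⟨j, -, hj, hlt⟩ | ⟨-, h⟩)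
    · exact ⟨j, hj, hlt⟩
    · exact h

/-- If `x` agrees with `p` before `d` and is lexicographically smaller, then `x d ≤ p d`. -/
theorem lexLt.apply_le {n : ℕ} {d : Fin n} {x p : Fin n → ℤ} (h : lexLt x p)
    (hx : ∀ j : Fin n, j < d → x j = p j) : x d ≤ p d := by
  obtain ⟨j, hj, hlt⟩ := h
  rcases lt_trichotomy j d with hjd | rfl | hjd
  · exact absurd (hx j hjd) hlt.ne
  · exact hlt.le
  · exact (hj d hjd).le

theorem card_filter_lexLt_eq_add {n : ℕ} (S : Finset (Fin n → ℤ)) (p : Fin n → ℤ) (d : Fin n) :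
    (S.filter (fun x => lexLt x p)).card =
      (S.filter (fun x =>
        ∃ j : Fin n, j < d ∧ (∀ k : Fin n, k < j → x k = p k) ∧ x j < p j)).card +
      ((S.filter (fun x => ∀ j : Fin n, j < d → x j = p j)).filter
        (fun x => lexLt x p)).card := by
  rw [Finset.filter_filter, ← Finset.card_union_of_disjoint, ← Finset.filter_or]
  · exact congrArg Finset.card (Finset.filter_congr fun x _ => lexLt_iff_prefix d x p)
  · refine Finset.disjoint_filter.2 ?_
    rintro x - ⟨j, hjd, -, hlt⟩ ⟨hx, -⟩
    exact hlt.ne (hx j hjd)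

/-- Full correctness of Algorithm 1.  Let `S ⊆ ℤ^D` (`D ≥ 1`) be finite, `i < |S|`, and let
`p` be the `i`-th element of `S` in lexicographic order (i.e. `p ∈ S` and exactly `i`
elements of `S` are lex-smaller than `p`).  For each coordinate `d`, set
`S_d = {x ∈ S : x_j = p_j for all j < d}` and
`i_d = i − |{x ∈ S : (x_1, …, x_{d−1}) <_lex (p_1, …, p_{d−1})}|`.  Then `p_d` is the
unique integer `a` with `|{x ∈ S_d : x_d < a}| ≤ i_d < |{x ∈ S_d : x_d ≤ a}|`. -/
theorem ith_lex_point_all_coordinates (D : ℕ) (hD : 1 ≤ D) (S : Finset (Fin D → ℤ))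
    (i : ℕ) (hi : i < S.card) (p : Fin D → ℤ) (hp : p ∈ S)
    (hip : (S.filter (fun x => lexLt x p)).card = i) :
    ∀ d : Fin D,
      ∀ Sd : Finset (Fin D → ℤ),
        Sd = S.filter (fun x => ∀ j : Fin D, j < d → x j = p j) →
      ∀ id : ℕ,
        id = i - (S.filter (fun x =>
          ∃ j : Fin D, j < d ∧ (∀ k : Fin D, k < j → x k = p k) ∧ x j < p j)).card →
      ((Sd.filter (fun x => x d < p d)).card ≤ id ∧
          id < (Sd.filter (fun x => x d ≤ p d)).card) ∧
        ∀ a : ℤ,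
          ((Sd.filter (fun x => x d < a)).card ≤ id ∧
            id < (Sd.filter (fun x => x d ≤ a)).card) → a = p d := by
  rintro d Sd rfl id hid
  rw [← hip, card_filter_lexLt_eq_add S p d, Nat.add_sub_cancel_left] at hid
  subst hid
  set T := S.filter (fun x => ∀ j : Fin D, j < d → x j = p j)
  have hmem : ∀ x ∈ T, ∀ j : Fin D, j < d → x j = p j := fun x hx => (Finset.mem_filter.1 hx).2
  have hpT : p ∈ T := Finset.mem_filter.2 ⟨hp, fun _ _ => rfl⟩
  have hlow : (T.filter (fun x => x d < p d)).card ≤ (T.filter (fun x => lexLt x p)).card :=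
    Finset.card_le_card fun x hx => by
      rw [Finset.mem_filter] at hx ⊢
      exact ⟨hx.1, d, hmem x hx.1, hx.2⟩
  have hup : (T.filter (fun x => lexLt x p)).card < (T.filter (fun x => x d ≤ p d)).card := by
    refine Finset.card_lt_card ((Finset.ssubset_iff_of_subset fun x hx => ?_).2
      ⟨p, Finset.mem_filter.2 ⟨hpT, le_rfl⟩, fun h => not_lexLt_self p (Finset.mem_filter.1 h).2⟩)
    rw [Finset.mem_filter] at hx ⊢
    exact ⟨hx.1, hx.2.apply_le (hmem x hx.1)⟩
  refine ⟨⟨hlow, hup⟩, fun a ⟨ha, ha'⟩ => ?_⟩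
  have mono : ∀ b c : ℤ, b < c →
      (T.filter (fun x => x d ≤ b)).card ≤ (T.filter (fun x => x d < c)).card := fun b c hbc =>
    Finset.card_le_card (Finset.monotone_filter_right T fun x _ (hx : x d ≤ b) => hx.trans_lt hbc)
  rcases lt_trichotomy a (p d) with h | h | h
  · exact absurd (ha'.trans_le (mono _ _ h)) hlow.not_gt
  · exact h
  · exact absurd (hup.trans_le (mono _ _ h)) ha.not_gt
end
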